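/- Suppose ψ is an electrostatic potential for u (with parameter ε > 0) that is continuously differentiable up to the closure of Ω(u). Then ∫_{Ω(u)} (ε² |∂ₓψ(x,z)|² + |∂_zψ(x,z)|²) d(x,z) ≥ ∫_{-1}^{1} 1/(1+u(x)) dx. -/

import Mathlib

open MeasureTheory Set

/-- The region `Ω(u)` between the ground plate `z = -1` and the membrane `z = u(x)`. -/
def Omega (u : ℝ → ℝ) : Set (ℝ × ℝ) :=
  {p : ℝ × ℝ | -1 < p.1 ∧ p.1 < 1 ∧ -1 < p.2 ∧ p.2 < u p.1}

/-- Partial derivative of `ψ` with respect to the first (horizontal) variable `x`. -/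
noncomputable def pdx (ψ : ℝ → ℝ → ℝ) (x z : ℝ) : ℝ := deriv (fun x' => ψ x' z) x

/-- Partial derivative of `ψ` with respect to the second (vertical) variable `z`. -/
noncomputable def pdz (ψ : ℝ → ℝ → ℝ) (x z : ℝ) : ℝ := deriv (fun z' => ψ x z') z

/-- Second partial derivative of `ψ` in `x`. -/
noncomputable def pdxx (ψ : ℝ → ℝ → ℝ) (x z : ℝ) : ℝ := deriv (fun x' => pdx ψ x' z) x

/-- Second partial derivative of `ψ` in `z`. -/
noncomputable def pdzz (ψ : ℝ → ℝ → ℝ) (x z : ℝ) : ℝ := deriv (fun z' => pdz ψ x z') z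

/-- Mixed partial derivative `∂ₓ∂_z ψ`. -/
noncomputable def pdxz (ψ : ℝ → ℝ → ℝ) (x z : ℝ) : ℝ := deriv (fun x' => pdz ψ x' z) x

/-- A function that is `C¹` on a compact set has bounded derivative on every open subset. -/
theorem exists_bound_fderiv_of_contDiffOn {E F : Type*} [NormedAddCommGroup E] [NormedSpace ℝ E]
    [NormedAddCommGroup F] [NormedSpace ℝ F] {f : E → F} {s U : Set E} (hs : IsCompact s)
    (hU : IsOpen U) (hUs : U ⊆ s) (hf : ContDiffOn ℝ 1 f s) :
    ∃ C, ∀ q ∈ U, ‖fderiv ℝ f q‖ ≤ C := by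
  suffices h : ∃ C, ∀ q ∈ s, q ∈ U → ‖fderiv ℝ f q‖ ≤ C by
    obtain ⟨C, hC⟩ := h
    exact ⟨C, fun q hq => hC q (hUs hq) hq⟩
  refine hs.induction_on (p := fun t => ∃ C, ∀ q ∈ t, q ∈ U → ‖fderiv ℝ f q‖ ≤ C) ?_ ?_ ?_ ?_
  · exact ⟨0, by simp⟩
  · rintro t t' htt' ⟨C, hC⟩
    exact ⟨C, fun q hq => hC q (htt' hq)⟩
  · rintro t t' ⟨C, hC⟩ ⟨C', hC'⟩
    refine ⟨max C C', fun q hq hqU => ?_⟩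
    rcases hq with hq | hq
    · exact (hC q hq hqU).trans (le_max_left _ _)
    · exact (hC' q hq hqU).trans (le_max_right _ _)
  · intro p hp
    have h1 : ContDiffWithinAt ℝ (0 + 1) f s p := by simpa using hf p hp
    obtain ⟨v, hv, -, f', hf', hf'c⟩ :=
      (contDiffWithinAt_succ_iff_hasFDerivWithinAt (by simp)).1 h1
    rw [insert_eq_of_mem hp] at hv
    have hbd : ∀ᶠ q in nhdsWithin p v, ‖f' q‖ < ‖f' p‖ + 1 :=
      hf'c.continuousWithinAt.norm.eventually (gt_mem_nhds (lt_add_one _))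
    have hbd' : {q | ‖f' q‖ < ‖f' p‖ + 1} ∩ v ∈ nhdsWithin p s := by
      obtain ⟨w, hw, hwv⟩ := mem_nhdsWithin_iff_exists_mem_nhds_inter.1 hbd
      filter_upwards [hv, mem_nhdsWithin_of_mem_nhds hw] with q hqv hqw
      exact ⟨hwv ⟨hqw, hqv⟩, hqv⟩
    refine ⟨s ∩ ({q | ‖f' q‖ < ‖f' p‖ + 1} ∩ interior (v ∪ sᶜ)), ?_, ‖f' p‖ + 1, ?_⟩
    · have hi : interior (v ∪ sᶜ) ∈ nhdsWithin p s := by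
        refine mem_nhdsWithin_of_mem_nhds (interior_mem_nhds.2 ?_)
        rw [mem_nhdsWithin_iff_eventually] at hv
        filter_upwards [hv] with q hq
        by_cases hqs : q ∈ s
        · exact Or.inl (hq hqs)
        · exact Or.inr hqs
      filter_upwards [hbd', hi, self_mem_nhdsWithin] with q h1 h2 h3
      exact ⟨h3, h1.1, h2⟩
    · rintro q ⟨hqs, hqb, hqi⟩ hqU
      have hvq : v ∈ nhds q := by
        filter_upwards [isOpen_interior.mem_nhds hqi, hU.mem_nhds hqU] with y hy hyU
        exact (interior_subset hy).resolve_right (not_not.2 (hUs hyU))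
      rw [((hf' q (mem_of_mem_nhds hvq)).hasFDerivAt hvq).fderiv]
      exact le_of_lt hqb

/-- Cauchy–Schwarz in one variable: a function rising by one over `[a, b]` has Dirichlet energy
at least `1 / (b - a)`. -/
theorem one_div_le_setIntegral_deriv_sq {a b C : ℝ} (hab : a < b) {f f' : ℝ → ℝ}
    (hf : ContinuousOn f (Icc a b)) (hf' : ∀ z ∈ Ioo a b, HasDerivAt f (f' z) z)
    (hc : ContinuousOn f' (Ioo a b)) (hC : ∀ z ∈ Ioo a b, ‖f' z‖ ≤ C) (h : f b - f a = 1) :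
    1 / (b - a) ≤ ∫ z in Ioo a b, f' z ^ 2 := by
  have hint : IntegrableOn f' (Ioo a b) :=
    IntegrableOn.of_bound (by simp) (hc.aestronglyMeasurable measurableSet_Ioo) C
      (ae_restrict_of_forall_mem measurableSet_Ioo hC)
  have hint2 : IntegrableOn (fun z => f' z ^ 2) (Ioo a b) := by
    refine IntegrableOn.of_bound (by simp) ((hc.pow 2).aestronglyMeasurable measurableSet_Ioo)
      (C ^ 2) (ae_restrict_of_forall_mem measurableSet_Ioo fun z hz => ?_)
    rw [norm_pow]
    exact pow_le_pow_left₀ (norm_nonneg _) (hC z hz) 2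
  have hftc : ∫ z in Ioo a b, f' z = 1 := by
    rw [← integral_Ioc_eq_integral_Ioo, ← intervalIntegral.integral_of_le hab.le, ← h]
    refine intervalIntegral.integral_eq_sub_of_hasDerivAt_of_le hab.le hf hf' ?_
    rwa [intervalIntegrable_iff_integrableOn_Ioo_of_le hab.le]
  have hba : 0 < b - a := sub_pos.2 hab
  set c := 1 / (b - a) with hcdef
  have hconst : IntegrableOn (fun _ : ℝ => c ^ 2) (Ioo a b) := integrableOn_const (by simp)
  calc c = ∫ z in Ioo a b, (2 * c * f' z - c ^ 2) := by
        rw [integral_sub (hint.const_mul _) hconst, integral_const_mul, hftc]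
        simp [Measure.real, hba.le]
        rw [hcdef]
        field_simp
        ring
    _ ≤ ∫ z in Ioo a b, f' z ^ 2 := by
        refine setIntegral_mono_on ((hint.const_mul _).sub hconst) hint2 measurableSet_Ioo
          fun z _ => ?_
        nlinarith [sq_nonneg (f' z - c)]

theorem isOpen_Omega {u : ℝ → ℝ} (hu : ContinuousOn u (Icc (-1) 1)) : IsOpen (Omega u) := by
  have hc : ContinuousOn (fun p : ℝ × ℝ => u p.1 - p.2) (Ioo (-1 : ℝ) 1 ×ˢ Ioi (-1 : ℝ)) :=
    ((hu.mono Ioo_subset_Icc_self).comp continuousOn_fst fun p hp => hp.1).sub continuousOn_snd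
  have := hc.isOpen_inter_preimage (isOpen_Ioo.prod isOpen_Ioi) (isOpen_Ioi (a := (0 : ℝ)))
  convert this using 1
  ext p
  simp [Omega, and_assoc]

theorem Omega_subset_Icc {u : ℝ → ℝ} (hu : ∀ x ∈ Ioo (-1 : ℝ) 1, u x ≤ 0) :
    Omega u ⊆ Icc (-1 : ℝ) 1 ×ˢ Icc (-1 : ℝ) 0 := by
  rintro ⟨x, z⟩ ⟨h1, h2, h3, h4⟩
  exact ⟨⟨h1.le, h2.le⟩, h3.le, h4.le.trans (hu x ⟨h1, h2⟩)⟩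

theorem mk_mem_closure_Omega {u : ℝ → ℝ} {x z : ℝ} (hx : x ∈ Ioo (-1 : ℝ) 1) (hu : -1 < u x)
    (hz : z ∈ Icc (-1) (u x)) : (x, z) ∈ closure (Omega u) := by
  rw [← closure_Ioo hu.ne] at hz
  exact map_mem_closure (f := fun z : ℝ => (x, z)) (by fun_prop) hz
    fun y hy => ⟨hx.1, hx.2, hy.1, hy.2⟩

/-- For an electrostatic potential `ψ` for `u` that is continuously
differentiable up to the closure of `Ω(u)`, the Dirichlet energy dominates
`∫_{-1}^{1} dx/(1+u(x))`. -/
theorem dirichlet_energy_lower_bound (ε : ℝ) (hε : 0 < ε) (u : ℝ → ℝ) (ψ : ℝ → ℝ → ℝ)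
    (hu_cont : ContinuousOn u (Icc (-1) 1))
    (hu_m1 : u (-1) = 0) (hu_p1 : u 1 = 0)
    (hu_rng : ∀ x ∈ Ioo (-1 : ℝ) 1, -1 < u x ∧ u x ≤ 0)
    (hψ_c1 : ContDiffOn ℝ 1 (fun p : ℝ × ℝ => ψ p.1 p.2) (closure (Omega u)))
    (hψ_c2 : ContDiffOn ℝ 2 (fun p : ℝ × ℝ => ψ p.1 p.2) (Omega u))
    (hψ_pde : ∀ p ∈ Omega u, ε ^ 2 * pdxx ψ p.1 p.2 + pdzz ψ p.1 p.2 = 0)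
    (hψ_bc : ∀ p ∈ frontier (Omega u), ψ p.1 p.2 = (1 + p.2) / (1 + u p.1)) :
    ∫ p in Omega u, (ε ^ 2 * (pdx ψ p.1 p.2) ^ 2 + (pdz ψ p.1 p.2) ^ 2)
      ≥ ∫ x in (-1 : ℝ)..1, 1 / (1 + u x) := by
  set F : ℝ × ℝ → ℝ := fun p => ψ p.1 p.2
  have hopen : IsOpen (Omega u) := isOpen_Omega hu_cont
  have hsub := Omega_subset_Icc fun x hx => (hu_rng x hx).2
  have hbox : IsCompact (Icc (-1 : ℝ) 1 ×ˢ Icc (-1 : ℝ) 0) := isCompact_Icc.prod isCompact_Icc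
  have hcomp : IsCompact (closure (Omega u)) := hbox.closure_of_subset hsub
  have hfin : volume (Omega u) ≠ ⊤ := (measure_mono hsub).trans_lt hbox.measure_lt_top |>.ne
  obtain ⟨C, hC⟩ := exists_bound_fderiv_of_contDiffOn hcomp hopen subset_closure hψ_c1
  have hdiff : ∀ p ∈ Omega u, HasFDerivAt F (fderiv ℝ F p) p := fun p hp =>
    ((hψ_c2.differentiableOn (by norm_num)).differentiableAt (hopen.mem_nhds hp)).hasFDerivAt
  have hcont : ContinuousOn (fderiv ℝ F) (Omega u) :=
    hψ_c2.continuousOn_fderiv_of_isOpen hopen (by norm_num)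
  have hdx : ∀ p ∈ Omega u, pdx ψ p.1 p.2 = fderiv ℝ F p (1, 0) := fun p hp => by
    have hline : HasDerivAt (fun x => (x, p.2)) ((1 : ℝ), (0 : ℝ)) p.1 :=
      (hasDerivAt_id p.1).prodMk (hasDerivAt_const p.1 p.2)
    exact (HasFDerivAt.comp_hasDerivAt (l := F) p.1 (hdiff p hp) hline).deriv
  have hdz' : ∀ p ∈ Omega u, HasDerivAt (fun z => ψ p.1 z) (fderiv ℝ F p (0, 1)) p.2 :=
    fun p hp => by
      have hline : HasDerivAt (fun z => (p.1, z)) ((0 : ℝ), (1 : ℝ)) p.2 :=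
        (hasDerivAt_const p.2 p.1).prodMk (hasDerivAt_id p.2)
      exact HasFDerivAt.comp_hasDerivAt (l := F) p.2 (hdiff p hp) hline
  have hdz : ∀ p ∈ Omega u, pdz ψ p.1 p.2 = fderiv ℝ F p (0, 1) := fun p hp => (hdz' p hp).deriv
  have hdxc : ContinuousOn (fun p : ℝ × ℝ => pdx ψ p.1 p.2) (Omega u) :=
    (hcont.clm_apply continuousOn_const).congr hdx
  have hdzc : ContinuousOn (fun p : ℝ × ℝ => pdz ψ p.1 p.2) (Omega u) :=
    (hcont.clm_apply continuousOn_const).congr hdz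
  have hdxb : ∀ p ∈ Omega u, ‖pdx ψ p.1 p.2‖ ≤ C := fun p hp => by
    rw [hdx p hp]
    exact ((fderiv ℝ F p).le_opNorm _).trans (by simpa [Prod.norm_def] using hC p hp)
  have hdzb : ∀ p ∈ Omega u, ‖pdz ψ p.1 p.2‖ ≤ C := fun p hp => by
    rw [hdz p hp]
    exact ((fderiv ℝ F p).le_opNorm _).trans (by simpa [Prod.norm_def] using hC p hp)
  have hsq : ∀ {g : ℝ × ℝ → ℝ}, ContinuousOn g (Omega u) → (∀ p ∈ Omega u, ‖g p‖ ≤ C) →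
      IntegrableOn (fun p => g p ^ 2) (Omega u) := by
    intro g hg hgb
    refine IntegrableOn.of_bound hfin.lt_top ((hg.pow 2).aestronglyMeasurable hopen.measurableSet)
      (C ^ 2) (ae_restrict_of_forall_mem hopen.measurableSet fun p hp => ?_)
    rw [norm_pow]
    exact pow_le_pow_left₀ (norm_nonneg _) (hgb p hp) 2
  have hix := (hsq hdxc hdxb).const_mul (ε ^ 2)
  have hiz := hsq hdzc hdzb
  have hstep : ∫ p in Omega u, pdz ψ p.1 p.2 ^ 2
      ≤ ∫ p in Omega u, (ε ^ 2 * (pdx ψ p.1 p.2) ^ 2 + (pdz ψ p.1 p.2) ^ 2) :=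
    setIntegral_mono_on hiz (hix.add hiz) hopen.measurableSet fun p _ =>
      le_add_of_nonneg_left (by positivity)
  refine le_trans ?_ hstep
  have hind := (integrable_indicator_iff hopen.measurableSet).2 hiz
  rw [← integral_indicator hopen.measurableSet, Measure.volume_eq_prod, integral_prod _ hind,
    intervalIntegral.integral_of_le (by norm_num), integral_Ioc_eq_integral_Ioo,
    ← integral_indicator measurableSet_Ioo]
  have hpos : ∀ x ∈ Icc (-1 : ℝ) 1, 0 < 1 + u x := by
    intro x hx
    rcases eq_or_lt_of_le hx.1 with h | h
    · rw [← h, hu_m1]; norm_num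
    rcases eq_or_lt_of_le hx.2 with h' | h'
    · rw [h', hu_p1]; norm_num
    linarith [(hu_rng x ⟨h, h'⟩).1]
  have hint : IntegrableOn (fun x => 1 / (1 + u x)) (Ioo (-1) 1) :=
    ((continuousOn_const.div (continuousOn_const.add hu_cont)
      fun x hx => (hpos x hx).ne').integrableOn_Icc).mono_set Ioo_subset_Icc_self
  refine integral_mono (hint.integrable_indicator measurableSet_Ioo) hind.integral_prod_left
    fun x => ?_
  by_cases hx : x ∈ Ioo (-1 : ℝ) 1
  swap
  · rw [indicator_of_notMem hx]
    exact integral_nonneg fun z => indicator_nonneg (fun p _ => sq_nonneg _) _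
  rw [indicator_of_mem hx]
  have hux := (hu_rng x hx).1
  have hmem : ∀ z ∈ Ioo (-1) (u x), (x, z) ∈ Omega u := fun z hz => ⟨hx.1, hx.2, hz.1, hz.2⟩
  have hslice : (fun z => (Omega u).indicator (fun p => pdz ψ p.1 p.2 ^ 2) (x, z))
      = (Ioo (-1) (u x)).indicator fun z => pdz ψ x z ^ 2 := by
    ext z
    by_cases hz : z ∈ Ioo (-1) (u x)
    · rw [indicator_of_mem hz, indicator_of_mem (hmem z hz)]
    · rw [indicator_of_notMem hz, indicator_of_notMem fun h => hz ⟨h.2.2.1, h.2.2.2⟩]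
  have hcl : ∀ z ∈ Icc (-1) (u x), (x, z) ∈ closure (Omega u) := fun z hz =>
    mk_mem_closure_Omega hx hux hz
  have hmaps : Continuous fun z : ℝ => (x, z) := by fun_prop
  have hbot : ψ x (-1) = 0 := by
    have := hψ_bc (x, -1) ⟨hcl _ (left_mem_Icc.2 hux.le), fun h =>
      lt_irrefl _ (interior_subset h).2.2.1⟩
    simpa using this
  have htop : ψ x (u x) = 1 := by
    have := hψ_bc (x, u x) ⟨hcl _ (right_mem_Icc.2 hux.le), fun h =>
      lt_irrefl _ (interior_subset h).2.2.2⟩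
    rwa [div_self (by linarith : 1 + u x ≠ 0)] at this
  beta_reduce
  rw [hslice, integral_indicator measurableSet_Ioo, show 1 + u x = u x - -1 by ring]
  exact one_div_le_setIntegral_deriv_sq (f := ψ x) hux
    (hψ_c1.continuousOn.comp hmaps.continuousOn hcl)
    (fun z hz => (hdz' (x, z) (hmem z hz)).differentiableAt.hasDerivAt)
    (hdzc.comp hmaps.continuousOn hmem) (fun z hz => hdzb (x, z) (hmem z hz))
    (by rw [htop, hbot, sub_zero])
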